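/- In the smooth setting described below, the flow distorts the area of sets containing the support of the datum at most by the factor e^{t‖ω₀‖_∞}: for every t ∈ [0,T] and every measurable set E ⊂ ℂ with supp ω₀ ⊆ E, one has |X(t,E)| = ∫_E det DX(t,z) dA(z) ≤ e^{t‖ω₀‖_∞} · |E|. -/

import Mathlib

open MeasureTheory Complex ENNReal

/-- The Cauchy-type kernel `K(z) = e^{iθ}/(2πz)`. -/
noncomputable def Kker (θ : ℝ) (z : ℂ) : ℂ :=
  Complex.exp (θ * Complex.I) / (2 * Real.pi * z)

/-- The convolution `(K∗f)(x) = ∫ K(x−y) f(y) dA(y)` against Lebesgue measure on `ℂ`. -/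
noncomputable def Kconv (θ : ℝ) (f : ℂ → ℂ) (x : ℂ) : ℂ :=
  ∫ y, Kker θ (x - y) * f y

/-- The Wirtinger derivative `∂F = (∂_x F − i ∂_y F)/2` of `F : ℂ → ℂ` (real `fderiv`). -/
noncomputable def wdz (F : ℂ → ℂ) (z : ℂ) : ℂ :=
  (fderiv ℝ F z 1 - Complex.I * fderiv ℝ F z Complex.I) / 2

/-- The Wirtinger derivative `∂̄F = (∂_x F + i ∂_y F)/2` of `F : ℂ → ℂ` (real `fderiv`). -/
noncomputable def wdbar (F : ℂ → ℂ) (z : ℂ) : ℂ :=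
  (fderiv ℝ F z 1 + Complex.I * fderiv ℝ F z Complex.I) / 2

/-- The sup norm `‖g‖_∞ = sup_z |g z|` of a real valued function on `ℂ`. -/
noncomputable def supNorm (g : ℂ → ℝ) : ℝ := ⨆ z : ℂ, |g z|

/-- The smooth setting of Section 2: `θ ∈ [0,2π]`, `T > 0`, a smooth compactly supported
datum `ω₀`, a smooth compactly supported (in space) solution `ω` of the active scalar
equation `∂_t ω + v·∇ω = 0`, `v(t,·) = K∗ω(t,·)`, `ω(0,·) = ω₀`, and its smooth flow
`X` solving `∂_t X(t,z) = v(t,X(t,z))`, `X(0,z) = z`, where each `X(t,·)` is a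
bijective `C¹` map with everywhere positive Jacobian determinant. -/
structure SmoothSetting where
  θ : ℝ
  hθ : θ ∈ Set.Icc (0 : ℝ) (2 * Real.pi)
  T : ℝ
  hT : 0 < T
  ω₀ : ℂ → ℝ
  hω₀smooth : ContDiff ℝ (⊤ : ℕ∞) ω₀
  hω₀supp : HasCompactSupport ω₀
  ω : ℝ → ℂ → ℝ
  hωsmooth : ContDiff ℝ (⊤ : ℕ∞) (fun p : ℝ × ℂ => ω p.1 p.2)
  hωsupp : ∀ t : ℝ, HasCompactSupport (ω t)
  hωinit : ω 0 = ω₀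
  htransport : ∀ t ∈ Set.Icc (0 : ℝ) T, ∀ z : ℂ,
    deriv (fun s => ω s z) t
      + (Kconv θ (fun y => (ω t y : ℂ)) z).re * fderiv ℝ (ω t) z 1
      + (Kconv θ (fun y => (ω t y : ℂ)) z).im * fderiv ℝ (ω t) z Complex.I = 0
  X : ℝ → ℂ → ℂ
  hXsmooth : ContDiff ℝ (⊤ : ℕ∞) (fun p : ℝ × ℂ => X p.1 p.2)
  hXinit : ∀ z : ℂ, X 0 z = z
  hXflow : ∀ t ∈ Set.Icc (0 : ℝ) T, ∀ z : ℂ,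
    deriv (fun s => X s z) t = Kconv θ (fun y => (ω t y : ℂ)) (X t z)
  hXbij : ∀ t ∈ Set.Icc (0 : ℝ) T, Function.Bijective (X t)
  hXjac : ∀ t ∈ Set.Icc (0 : ℝ) T, ∀ z : ℂ,
    0 < LinearMap.det ((fderiv ℝ (X t) z) : ℂ →ₗ[ℝ] ℂ)

lemma fderiv_apply_eq_re_im (L : ℂ →L[ℝ] ℂ) (w : ℂ) : L w = w.re * L 1 + w.im * L I := by
  have h : w = w.re • (1 : ℂ) + w.im • I := by simp
  conv_lhs => rw [h]
  rw [map_add, map_smul, map_smul, real_smul, real_smul]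

/-- The unit vector with argument `φ`. -/
noncomputable def unitVec (φ : ℝ) : ℂ := Real.cos φ + Real.sin φ * I

lemma hasDerivAt_unitVec (φ : ℝ) : HasDerivAt unitVec (I * unitVec φ) φ := by
  have h := ((Real.hasDerivAt_cos φ).ofReal_comp).add
    (((Real.hasDerivAt_sin φ).ofReal_comp).mul_const I)
  convert! h using 1
  simp only [unitVec]
  push_cast
  linear_combination Complex.sin φ * I_mul_I

lemma continuous_unitVec : Continuous unitVec :=
  continuous_iff_continuousAt.2 fun φ => (hasDerivAt_unitVec φ).continuousAt

lemma norm_unitVec (φ : ℝ) : ‖unitVec φ‖ = 1 := by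
  simp [unitVec, Complex.norm_cos_add_sin_mul_I]

lemma unitVec_ne_zero (φ : ℝ) : unitVec φ ≠ 0 := norm_ne_zero_iff.1 (by simp [norm_unitVec])

lemma integrableOn_polar {h : ℝ × ℝ → ℂ} (hh : Continuous h) {R : ℝ}
    (hR : ∀ p : ℝ × ℝ, R < p.1 → h p = 0) :
    IntegrableOn h (Set.Ioi (0 : ℝ) ×ˢ Set.Ioo (-Real.pi) Real.pi) := by
  have hK : IsCompact (Set.Icc (0 : ℝ) R ×ˢ Set.Icc (-Real.pi) Real.pi) :=
    isCompact_Icc.prod isCompact_Icc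
  have h1 := hh.continuousOn.integrableOn_compact (μ := volume) hK
  refine IntegrableOn.of_forall_sdiff_eq_zero h1 (by measurability) ?_
  rintro ⟨r, φ⟩ ⟨⟨hr, hφ⟩, hn⟩
  apply hR
  by_contra hle
  exact hn ⟨⟨le_of_lt hr, not_lt.1 hle⟩, ⟨hφ.1.le, hφ.2.le⟩⟩

lemma hasDerivAt_radial {g : ℂ → ℂ} (hg : ContDiff ℝ 1 g) (r φ : ℝ) :
    HasDerivAt (fun r : ℝ => g (r * unitVec φ)) (fderiv ℝ g (r * unitVec φ) (unitVec φ)) r := by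
  have h1 : HasDerivAt (fun r : ℝ => (r : ℂ) * unitVec φ) (unitVec φ) r := by
    simpa using (HasDerivAt.ofReal_comp (hasDerivAt_id r)).mul_const (unitVec φ)
  exact ((hg.differentiable one_ne_zero _).hasFDerivAt).comp_hasDerivAt r h1

lemma hasDerivAt_angular {g : ℂ → ℂ} (hg : ContDiff ℝ 1 g) (r φ : ℝ) :
    HasDerivAt (fun φ : ℝ => g (r * unitVec φ))
      (r • fderiv ℝ g (r * unitVec φ) (I * unitVec φ)) φ := by
  have h1 : HasDerivAt (fun φ : ℝ => (r : ℂ) * unitVec φ) (r • (I * unitVec φ)) φ := by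
    simpa using (hasDerivAt_unitVec φ).const_mul (r : ℂ)
  have := ((hg.differentiable one_ne_zero _).hasFDerivAt).comp_hasDerivAt φ h1
  simpa only [map_smul] using! this

lemma integral_radial {g : ℂ → ℂ} (hg : ContDiff ℝ 1 g) (hc : HasCompactSupport g) (φ : ℝ) :
    ∫ r in Set.Ioi (0 : ℝ), fderiv ℝ g (r * unitVec φ) (unitVec φ) = - g 0 := by
  have hd : deriv (fun r : ℝ => g (r * unitVec φ))
      = fun r : ℝ => fderiv ℝ g (r * unitVec φ) (unitVec φ) :=
    funext fun r => (hasDerivAt_radial hg r φ).deriv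
  have hcd : ContDiff ℝ 1 (fun r : ℝ => g (r * unitVec φ)) :=
    hg.comp (ofRealCLM.contDiff.mul contDiff_const)
  have hcs : HasCompactSupport (fun r : ℝ => g (r * unitVec φ)) := by
    obtain ⟨R, hR⟩ := hc.isCompact.isBounded.subset_closedBall 0
    refine HasCompactSupport.of_support_subset_isCompact (isCompact_closedBall (0 : ℝ) R) ?_
    intro r hr
    have := hR (subset_tsupport g (Function.mem_support.2 hr))
    simpa [norm_unitVec] using this
  have := hcs.integral_Ioi_deriv_eq hcd 0
  rw [hd] at this
  simpa using this

lemma integral_angular {g : ℂ → ℂ} (hg : ContDiff ℝ 1 g) {r : ℝ} (hr : 0 < r) :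
    ∫ φ in Set.Ioo (-Real.pi) Real.pi, fderiv ℝ g (r * unitVec φ) (I * unitVec φ) = 0 := by
  have hcont : Continuous fun φ : ℝ => r • fderiv ℝ g (r * unitVec φ) (I * unitVec φ) := by
    have := continuous_unitVec
    have h2 := hg.continuous_fderiv one_ne_zero
    fun_prop
  have h := intervalIntegral.integral_eq_sub_of_hasDerivAt (a := -Real.pi) (b := Real.pi)
    (fun φ _ => hasDerivAt_angular hg r φ) (hcont.intervalIntegrable _ _)
  rw [intervalIntegral.integral_of_le (by linarith [Real.pi_pos]), integral_smul,
    integral_Ioc_eq_integral_Ioo] at h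
  have h3 : unitVec Real.pi = unitVec (-Real.pi) := by simp [unitVec]
  rw [h3, sub_self] at h
  exact (smul_eq_zero.1 h).resolve_left hr.ne'

/-- The Cauchy–Pompeiu formula at the origin. -/
lemma integral_inv_mul_wdbar {g : ℂ → ℂ} (hg : ContDiff ℝ 1 g) (hc : HasCompactSupport g) :
    ∫ y, y⁻¹ * wdbar g y = - (Real.pi * g 0) := by
  have hu := continuous_unitVec
  have hcd := hg.continuous_fderiv one_ne_zero
  set A : ℝ × ℝ → ℂ := fun p => fderiv ℝ g (p.1 * unitVec p.2) (unitVec p.2) with hA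
  set B : ℝ × ℝ → ℂ := fun p => fderiv ℝ g (p.1 * unitVec p.2) (I * unitVec p.2) with hB
  obtain ⟨R, hR⟩ := (hc.fderiv ℝ).isCompact.isBounded.subset_closedBall 0
  have hzero : ∀ p : ℝ × ℝ, R < p.1 → fderiv ℝ g (p.1 * unitVec p.2) = 0 := by
    intro p hp
    by_contra hne
    have := hR (subset_tsupport _ (Function.mem_support.2 hne))
    simp [norm_unitVec] at this
    exact absurd (le_trans (le_abs_self _) this) (not_le.2 hp)
  have hAi := integrableOn_polar (h := A) (by fun_prop) (R := R)
    (fun p hp => by simp [hA, hzero p hp])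
  have hBi := integrableOn_polar (h := B) (by fun_prop) (R := R)
    (fun p hp => by simp [hB, hzero p hp])
  have hAint : ∫ p in Set.Ioi (0 : ℝ) ×ˢ Set.Ioo (-Real.pi) Real.pi, A p
      = -(2 * Real.pi * g 0) := by
    rw [Measure.volume_eq_prod] at hAi ⊢
    rw [← setIntegral_prod_swap, setIntegral_prod (fun z => A z.swap) hAi.swap]
    simp only [hA, Prod.swap_prod_mk, integral_radial hg hc]
    simp [Real.pi_pos.le]
    left
    ring
  have hBint : ∫ p in Set.Ioi (0 : ℝ) ×ˢ Set.Ioo (-Real.pi) Real.pi, B p = 0 := by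
    rw [Measure.volume_eq_prod] at hBi ⊢
    rw [setIntegral_prod _ hBi]
    rw [setIntegral_congr_fun (g := fun _ => (0 : ℂ)) measurableSet_Ioi
      (fun r hr => integral_angular hg hr)]
    simp
  rw [← Complex.integral_comp_polarCoord_symm, polarCoord_target]
  have hcongr : ∀ p ∈ Set.Ioi (0 : ℝ) ×ˢ Set.Ioo (-Real.pi) Real.pi,
      p.1 • ((Complex.polarCoord.symm p)⁻¹ * wdbar g (Complex.polarCoord.symm p))
        = (1 / 2) * A p + (I / 2) * B p := by
    rintro ⟨r, φ⟩ ⟨hr, -⟩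
    have hr : (r : ℂ) ≠ 0 := by exact_mod_cast (ne_of_gt hr)
    have hs : Complex.polarCoord.symm (r, φ) = r * unitVec φ := by simp [unitVec]
    have hune := unitVec_ne_zero φ
    have hcs : (Real.cos φ : ℂ) ^ 2 + (Real.sin φ : ℂ) ^ 2 = 1 := by
      exact_mod_cast Real.cos_sq_add_sin_sq φ
    have hinv : (unitVec φ)⁻¹ = Real.cos φ - Real.sin φ * I := by
      apply inv_eq_of_mul_eq_one_right
      simp only [unitVec]
      linear_combination hcs - (Real.sin φ : ℂ) ^ 2 * I_mul_I
    rw [hs, mul_inv, hinv, hA, hB, wdbar]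
    simp only
    rw [fderiv_apply_eq_re_im _ (unitVec φ), fderiv_apply_eq_re_im _ (I * unitVec φ)]
    have h1 : (unitVec φ).re = Real.cos φ := by simp [unitVec, Complex.cos_ofReal_re]
    have h2 : (unitVec φ).im = Real.sin φ := by simp [unitVec, Complex.sin_ofReal_re]
    simp only [mul_re, mul_im, h1, h2, I_re, I_im, real_smul]
    push_cast
    field_simp
    ring_nf
    simp only [I_sq]
    ring
  rw [setIntegral_congr_fun (measurableSet_Ioi.prod measurableSet_Ioo) hcongr,
    integral_add (hAi.const_mul _) (hBi.const_mul _), integral_const_mul, integral_const_mul, hAint,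
    hBint]
  ring

lemma norm_Kker (θ : ℝ) (z : ℂ) : ‖Kker θ z‖ = (2 * Real.pi)⁻¹ * ‖z‖⁻¹ := by
  rw [Kker, norm_div, Complex.norm_exp_ofReal_mul_I]
  simp [abs_of_pos Real.pi_pos, mul_comm]

lemma Kker_eq (θ : ℝ) (z : ℂ) : Kker θ z = exp (θ * I) / (2 * Real.pi) * z⁻¹ := by
  rw [Kker, div_mul_eq_div_div, div_eq_mul_inv _ z]

lemma locallyIntegrable_Kker (θ : ℝ) : LocallyIntegrable (Kker θ) := by
  refine locallyIntegrable_of_norm_le_rpow (C := (2 * Real.pi)⁻¹) (α := 1) ?_ ?_ ?_ ?_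
  · simp
  · simp
  · exact .of_forall fun z => by rw [norm_Kker, Real.rpow_neg_one]
  · exact Measurable.aestronglyMeasurable (by unfold Kker; fun_prop)

lemma Kconv_eq_convolution (θ : ℝ) (f : ℂ → ℂ) :
    Kconv θ f = convolution (Kker θ) f (ContinuousLinearMap.mul ℝ ℂ) volume := by
  ext x
  rw [convolution_eq_swap]
  rfl

lemma contDiff_Kconv (θ : ℝ) {f : ℂ → ℂ} {n : ℕ∞} (hf : ContDiff ℝ n f)
    (hc : HasCompactSupport f) : ContDiff ℝ n (Kconv θ f) := by
  rw [Kconv_eq_convolution]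
  exact hc.contDiff_convolution_right _ (locallyIntegrable_Kker θ) hf

lemma integrable_Kker_mul_comp_sub (θ : ℝ) {f : ℂ → ℂ} (hf : Continuous f)
    (hc : HasCompactSupport f) (x : ℂ) : Integrable fun t => Kker θ t * f (x - t) :=
  hc.convolutionExists_right (ContinuousLinearMap.mul ℝ ℂ) (locallyIntegrable_Kker θ) hf x

lemma fderiv_Kconv_apply (θ : ℝ) {f : ℂ → ℂ} (hf : ContDiff ℝ 1 f) (hc : HasCompactSupport f)
    (x w : ℂ) : fderiv ℝ (Kconv θ f) x w = ∫ t, Kker θ t * fderiv ℝ f (x - t) w := by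
  rw [Kconv_eq_convolution,
    (hc.hasFDerivAt_convolution_right _ (locallyIntegrable_Kker θ) hf x).fderiv]
  have h := (hc.fderiv ℝ).convolutionExists_right
    ((ContinuousLinearMap.mul ℝ ℂ).precompR ℂ) (locallyIntegrable_Kker θ)
    (hf.continuous_fderiv one_ne_zero) x
  rw [convolution, ContinuousLinearMap.integral_apply h]
  rfl

/-- `K` is a fundamental solution of `∂̄` up to the factor `e^{iθ}/2`. -/
lemma wdbar_Kconv (θ : ℝ) {f : ℂ → ℂ} (hf : ContDiff ℝ 1 f) (hc : HasCompactSupport f) (x : ℂ) :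
    wdbar (Kconv θ f) x = exp (θ * I) / 2 * f x := by
  have hg : ContDiff ℝ 1 fun t => f (x - t) := hf.comp (contDiff_const.sub contDiff_id)
  have hgc : HasCompactSupport fun t => f (x - t) :=
    hc.comp_homeomorph (Homeomorph.subLeft x)
  have hdc : ∀ w, HasCompactSupport fun y => fderiv ℝ f y w := fun w => hc.fderiv_apply ℝ w
  have hd : ∀ w, Continuous fun y => fderiv ℝ f y w := fun w =>
    (hf.continuous_fderiv one_ne_zero).clm_apply continuous_const
  have hw : ∀ t, wdbar (fun t => f (x - t)) t = - wdbar f (x - t) := by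
    intro t
    have h : ∀ w, fderiv ℝ (fun t => f (x - t)) t w = - fderiv ℝ f (x - t) w := by
      intro w
      have := ((hf.differentiable one_ne_zero (x - t)).hasFDerivAt).comp t
        ((hasFDerivAt_id t).const_sub x)
      simpa using! congrArg (fun L : ℂ →L[ℝ] ℂ => L w) this.fderiv
    simp only [wdbar, h]
    ring
  have key := integral_inv_mul_wdbar hg hgc
  simp only [hw, sub_zero] at key
  have hint : ∀ w, Integrable fun t => Kker θ t * fderiv ℝ f (x - t) w := fun w =>
    integrable_Kker_mul_comp_sub θ (hd w) (hdc w) x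
  have hpi : (Real.pi : ℂ) ≠ 0 := by exact_mod_cast Real.pi_ne_zero
  calc wdbar (Kconv θ f) x
      = ∫ t, ((Kker θ t * fderiv ℝ f (x - t) 1) + I * (Kker θ t * fderiv ℝ f (x - t) I)) / 2 := by
        rw [wdbar, fderiv_Kconv_apply θ hf hc, fderiv_Kconv_apply θ hf hc, ← integral_const_mul,
          ← integral_add (hint 1) ((hint I).const_mul I), ← integral_div]
    _ = ∫ t, -(exp (θ * I) / (2 * Real.pi)) * (t⁻¹ * - wdbar f (x - t)) := by
        congr 1
        ext t
        rw [Kker_eq, wdbar]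
        ring
    _ = exp (θ * I) / 2 * f x := by
        rw [integral_const_mul, key]
        field_simp

lemma norm_Kconv_le (θ : ℝ) {f : ℂ → ℂ} (hf : Continuous f) (hc : HasCompactSupport f) {R : ℝ}
    (hR : tsupport f ⊆ Metric.closedBall 0 R) {x : ℂ} (hx : 2 * R ≤ ‖x‖) (hx0 : 0 < ‖x‖) :
    ‖Kconv θ f x‖ ≤ (∫ y, ‖f y‖) / ‖x‖ := by
  have h : ∀ y, ‖Kker θ (x - y) * f y‖ ≤ ‖f y‖ * ‖x‖⁻¹ := by
    intro y
    by_cases hy : f y = 0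
    · simp [hy]
    have hyR : ‖y‖ ≤ R := by simpa using hR (subset_tsupport f (Function.mem_support.2 hy))
    have h1 : ‖x‖ / 2 ≤ ‖x - y‖ := by linarith [norm_sub_norm_le x y]
    rw [norm_mul, norm_Kker, mul_comm]
    gcongr
    have h2 : ‖x - y‖⁻¹ ≤ 2 * ‖x‖⁻¹ := by
      rw [show 2 * ‖x‖⁻¹ = (‖x‖ / 2)⁻¹ by rw [inv_div]; rfl]
      gcongr
    have h3 : (2 * Real.pi)⁻¹ ≤ 2⁻¹ := by
      gcongr
      linarith [Real.pi_gt_three]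
    calc (2 * Real.pi)⁻¹ * ‖x - y‖⁻¹ ≤ 2⁻¹ * (2 * ‖x‖⁻¹) := by gcongr
      _ = ‖x‖⁻¹ := by ring
  have := norm_integral_le_of_norm_le (μ := volume)
    (((hf.integrable_of_hasCompactSupport hc).norm).mul_const _)
    (.of_forall h)
  rwa [integral_mul_const] at this

/-- `u` is holomorphic and of size `O(|z|^{-k})` near infinity. -/
def HolomorphicDecay (k : ℕ) (u : ℂ → ℂ) : Prop :=
  ∃ r C : ℝ, 1 ≤ r ∧ ∀ z, r ≤ ‖z‖ → wdbar u z = 0 ∧ ‖u z‖ ≤ C / ‖z‖ ^ k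

lemma differentiableAt_of_wdbar_eq_zero {u : ℂ → ℂ} {z : ℂ} (hu : DifferentiableAt ℝ u z)
    (h : wdbar u z = 0) : DifferentiableAt ℂ u z ∧ ∀ w, fderiv ℝ u z w = w * deriv u z := by
  have h1 : fderiv ℝ u z I = I * fderiv ℝ u z 1 := by
    rw [wdbar] at h
    linear_combination (-2 * I) * h + (fderiv ℝ u z I) * I_mul_I
  have h2 : DifferentiableAt ℂ u z :=
    differentiableAt_complex_iff_differentiableAt_real.2 ⟨hu, by simpa using h1⟩
  refine ⟨h2, fun w => ?_⟩
  have h3 := h2.hasDerivAt.complexToReal_fderiv.fderiv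
  rw [h3]
  simp [mul_comm]

lemma HolomorphicDecay.fderiv_le {k : ℕ} {u : ℂ → ℂ} (h : HolomorphicDecay k u)
    (hu : ContDiff ℝ 1 u) :
    ∃ r C : ℝ, 1 ≤ r ∧ 0 ≤ C ∧ ∀ z, r ≤ ‖z‖ → ∀ w, ‖fderiv ℝ u z w‖ ≤ C / ‖z‖ ^ (k + 1) * ‖w‖ := by
  obtain ⟨r, C, hr, H⟩ := h
  have hud := hu.differentiable one_ne_zero
  refine ⟨2 * r, 2 ^ (k + 1) * |C|, by linarith, by positivity, fun z hz w => ?_⟩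
  have hz0 : 0 < ‖z‖ := by linarith
  have hball : ∀ y ∈ Metric.closedBall z (‖z‖ / 2), ‖z‖ / 2 ≤ ‖y‖ := by
    intro y hy
    rw [mem_closedBall_iff_norm] at hy
    have := norm_sub_norm_le z y
    rw [norm_sub_rev] at this
    linarith
  rw [(differentiableAt_of_wdbar_eq_zero (hud z) (H z (by linarith)).1).2, norm_mul, mul_comm]
  gcongr
  have hdiff : DifferentiableOn ℂ u (Metric.closedBall z (‖z‖ / 2)) := fun y hy =>
    (differentiableAt_of_wdbar_eq_zero (hud y)
      (H y (by linarith [hball y hy])).1).1.differentiableWithinAt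
  have := Complex.norm_deriv_le_of_forall_mem_sphere_norm_le (f := u) (c := z) (R := ‖z‖ / 2)
    (C := |C| / (‖z‖ / 2) ^ k) (by positivity) (hdiff.diffContOnCl_ball subset_rfl) ?_
  · refine this.trans_eq ?_
    rw [div_pow, pow_succ, pow_succ]
    field_simp
  · intro y hy
    have hy' := hball y (Metric.sphere_subset_closedBall hy)
    refine (H y (by linarith)).2.trans ?_
    gcongr
    exact le_abs_self C

lemma HolomorphicDecay.bound {k : ℕ} {u : ℂ → ℂ} (h : HolomorphicDecay k u) :
    ∃ r C : ℝ, 1 ≤ r ∧ 0 ≤ C ∧ ∀ z, r ≤ ‖z‖ → ‖u z‖ ≤ C / ‖z‖ ^ k := by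
  obtain ⟨r, C, hr, H⟩ := h
  refine ⟨r, |C|, hr, abs_nonneg _, fun z hz => (H z hz).2.trans ?_⟩
  gcongr
  exact le_abs_self C

lemma integrable_of_norm_le_div_pow_three {h : ℂ → ℂ} (hh : Continuous h) {r C : ℝ} (hr : 1 ≤ r)
    (H : ∀ z, r ≤ ‖z‖ → ‖h z‖ ≤ C / ‖z‖ ^ 3) : Integrable h := by
  have hint : Integrable fun z : ℂ => (1 + ‖z‖) ^ (-(3 : ℝ)) :=
    integrable_one_add_norm (by norm_num [Complex.finrank_real_complex])
  refine hh.locallyIntegrable.integrable_of_isBigO_cocompact ?_ (hint.integrableAtFilter _)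
  refine Asymptotics.IsBigO.of_bound (|C| * 8) ?_
  filter_upwards [(isCompact_closedBall (0 : ℂ) r).compl_mem_cocompact] with z hz
  have hz : r < ‖z‖ := by simpa using hz
  refine (H z hz.le).trans ?_
  have h0 : 0 < ‖z‖ := by linarith
  rw [Real.norm_of_nonneg (by positivity), Real.rpow_neg (by positivity)]
  norm_cast
  have h1 : (1 + ‖z‖) ^ 3 ≤ (2 * ‖z‖) ^ 3 := by
    gcongr
    linarith
  rw [← div_eq_mul_inv, div_le_div_iff₀ (by positivity) (by positivity)]
  calc C * (1 + ‖z‖) ^ 3 ≤ |C| * (2 * ‖z‖) ^ 3 := by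
        gcongr
        exact le_abs_self C
    _ = _ := by ring

lemma continuous_fderiv_apply {p : ℂ → ℂ} (hp : ContDiff ℝ 1 p) (u : ℂ) :
    Continuous fun x => fderiv ℝ p x u :=
  (hp.continuous_fderiv one_ne_zero).clm_apply continuous_const

lemma integral_mul_fderiv_combination {p w : ℂ → ℂ} (c : ℂ) (hp : ContDiff ℝ 1 p)
    (hw : ContDiff ℝ 1 w) (h1 : ∀ u, Integrable fun x => fderiv ℝ p x u * w x)
    (h2 : ∀ u, Integrable fun x => p x * fderiv ℝ w x u) (h3 : Integrable fun x => p x * w x) :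
    ∫ x, p x * ((fderiv ℝ w x 1 + c * fderiv ℝ w x I) / 2)
      = - ∫ x, (fderiv ℝ p x 1 + c * fderiv ℝ p x I) / 2 * w x := by
  have ibp : ∀ u, ∫ x, p x * fderiv ℝ w x u = - ∫ x, fderiv ℝ p x u * w x := fun u =>
    integral_mul_fderiv_eq_neg_fderiv_mul_of_integrable (h1 u) (h2 u) h3
      (fun x _ => hp.differentiable one_ne_zero x) (fun x _ => hw.differentiable one_ne_zero x)
  calc ∫ x, p x * ((fderiv ℝ w x 1 + c * fderiv ℝ w x I) / 2)
      = ∫ x, ((1 / 2) * (p x * fderiv ℝ w x 1) + (c / 2) * (p x * fderiv ℝ w x I)) := by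
        congr 1; ext x; ring
    _ = - ((1 / 2) * (∫ x, fderiv ℝ p x 1 * w x) + (c / 2) * ∫ x, fderiv ℝ p x I * w x) := by
        rw [integral_add ((h2 1).const_mul _) ((h2 I).const_mul _), integral_const_mul,
          integral_const_mul, ibp, ibp]
        ring
    _ = - ∫ x, ((1 / 2) * (fderiv ℝ p x 1 * w x) + (c / 2) * (fderiv ℝ p x I * w x)) := by
        rw [integral_add ((h1 1).const_mul _) ((h1 I).const_mul _), integral_const_mul,
          integral_const_mul]
    _ = _ := by
        congr 2; ext x; ring

lemma wdz_eq (F : ℂ → ℂ) (z : ℂ) :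
    wdz F z = (fderiv ℝ F z 1 + (-I) * fderiv ℝ F z I) / 2 := by
  rw [wdz]; ring

lemma contDiff_wdz {F : ℂ → ℂ} (hF : ContDiff ℝ 2 F) : ContDiff ℝ 1 (wdz F) := by
  have h : ContDiff ℝ 1 (fderiv ℝ F) := hF.fderiv_right (by norm_num)
  exact ((h.clm_apply contDiff_const).sub
    (contDiff_const.mul (h.clm_apply contDiff_const))).div_const 2

lemma fderiv_fderiv_apply {F : ℂ → ℂ} (hF : ContDiff ℝ 2 F) (z u w : ℂ) :
    fderiv ℝ (fun y => fderiv ℝ F y w) z u = fderiv ℝ (fderiv ℝ F) z u w := by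
  have h : DifferentiableAt ℝ (fderiv ℝ F) z :=
    (hF.fderiv_right (m := 1) (by norm_num)).differentiable one_ne_zero z
  rw [fderiv_clm_apply h (differentiableAt_const w)]
  simp

lemma fderiv_combination {F : ℂ → ℂ} (hF : ContDiff ℝ 2 F) (c z u : ℂ) :
    fderiv ℝ (fun y => (fderiv ℝ F y 1 + c * fderiv ℝ F y I) / 2) z u
      = (fderiv ℝ (fderiv ℝ F) z u 1 + c * fderiv ℝ (fderiv ℝ F) z u I) / 2 := by
  have h : ContDiff ℝ 1 (fderiv ℝ F) := hF.fderiv_right (by norm_num)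
  have hd : ∀ w, DifferentiableAt ℝ (fun y => fderiv ℝ F y w) z := fun w =>
    (h.clm_apply contDiff_const).differentiable one_ne_zero z
  have := (((hd 1).hasFDerivAt.add ((hd I).hasFDerivAt.const_mul c)).mul_const (2 : ℂ)⁻¹).fderiv
  have e := congrArg (fun L : ℂ →L[ℝ] ℂ => L u) this
  simp only [div_eq_mul_inv]
  refine e.trans ?_
  simp [fderiv_fderiv_apply hF]
  ring

lemma wdbar_wdz {F : ℂ → ℂ} (hF : ContDiff ℝ 2 F) (z : ℂ) : wdbar (wdz F) z = wdz (wdbar F) z := by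
  have hs : IsSymmSndFDerivAt ℝ F z := hF.contDiffAt.isSymmSndFDerivAt (by simp)
  have e1 : wdz F = fun y => (fderiv ℝ F y 1 + (-I) * fderiv ℝ F y I) / 2 := funext (wdz_eq F)
  have e2 : wdbar F = fun y => (fderiv ℝ F y 1 + I * fderiv ℝ F y I) / 2 := rfl
  rw [wdbar, wdz, e1, e2]
  simp only [fderiv_combination hF]
  rw [hs.eq I 1]
  ring

lemma fderiv_conj_comp {F : ℂ → ℂ} (hF : ContDiff ℝ 1 F) (z u : ℂ) :
    fderiv ℝ (fun y => (starRingEnd ℂ) (F y)) z u = (starRingEnd ℂ) (fderiv ℝ F z u) := by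
  have h := (conjCLE.toContinuousLinearMap.hasFDerivAt (x := F z)).comp z
    (hF.differentiable one_ne_zero z).hasFDerivAt
  exact congrArg (fun L : ℂ →L[ℝ] ℂ => L u) h.fderiv

lemma holomorphicDecay_Kconv (θ : ℝ) {f : ℂ → ℂ} (hf : ContDiff ℝ 1 f)
    (hc : HasCompactSupport f) : HolomorphicDecay 1 (Kconv θ f) := by
  obtain ⟨R, hR⟩ := hc.isCompact.isBounded.subset_closedBall 0
  refine ⟨2 * |R| + 1, ∫ y, ‖f y‖, by linarith [abs_nonneg R], fun z hz => ⟨?_, ?_⟩⟩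
  · rw [wdbar_Kconv θ hf hc]
    have : f z = 0 := by
      by_contra hne
      have := hR (subset_tsupport f (Function.mem_support.2 hne))
      rw [mem_closedBall_zero_iff] at this
      linarith [abs_nonneg R, le_abs_self R]
    simp [this]
  · rw [pow_one]
    exact norm_Kconv_le θ hf.continuous hc hR (by linarith [le_abs_self R])
      (by linarith [abs_nonneg R])

lemma norm_combination_le {L : ℂ →L[ℝ] ℂ} {c : ℂ} {B : ℝ} (hc : ‖c‖ = 1)
    (hL : ∀ w, ‖L w‖ ≤ B * ‖w‖) : ‖(L 1 + c * L I) / 2‖ ≤ B := by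
  have h1 := hL 1
  have h2 := hL I
  rw [norm_one, mul_one] at h1
  rw [norm_I, mul_one] at h2
  rw [norm_div, Complex.norm_ofNat, div_le_iff₀ two_pos]
  calc ‖L 1 + c * L I‖ ≤ ‖L 1‖ + ‖c * L I‖ := norm_add_le _ _
    _ ≤ B * 2 := by rw [norm_mul, hc, one_mul]; linarith

lemma HolomorphicDecay.wdz {k : ℕ} {u : ℂ → ℂ} (h : HolomorphicDecay k u) (hu : ContDiff ℝ 2 u) :
    HolomorphicDecay (k + 1) (wdz u) := by
  obtain ⟨r, C, hr, -, H⟩ := h.fderiv_le (hu.of_le (by norm_num))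
  obtain ⟨r', C', hr', H'⟩ := h
  refine ⟨max r r' + 1, C, by linarith [le_max_left r r'], fun z hz => ⟨?_, ?_⟩⟩
  · rw [wdbar_wdz hu]
    have he : wdbar u =ᶠ[nhds z] fun _ => 0 := by
      have : ∀ᶠ y in nhds z, r' < ‖y‖ :=
        continuous_norm.continuousAt.eventually (lt_mem_nhds (by linarith [le_max_right r r']))
      filter_upwards [this] with y hy using (H' y hy.le).1
    simp [_root_.wdz, he.fderiv_eq]
  · rw [wdz_eq]
    exact norm_combination_le (by simp) (H z (by linarith [le_max_left r r']))

lemma integrable_mul_of_bounds {p q : ℂ → ℂ} (hp : Continuous p) (hq : Continuous q) {j k : ℕ}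
    (hjk : 3 ≤ j + k) (hpb : ∃ r C : ℝ, 1 ≤ r ∧ 0 ≤ C ∧ ∀ z, r ≤ ‖z‖ → ‖p z‖ ≤ C / ‖z‖ ^ j)
    (hqb : ∃ r C : ℝ, 1 ≤ r ∧ 0 ≤ C ∧ ∀ z, r ≤ ‖z‖ → ‖q z‖ ≤ C / ‖z‖ ^ k) :
    Integrable fun z => p z * q z := by
  obtain ⟨r, C, hr, hC, H⟩ := hpb
  obtain ⟨r', C', hr', hC', H'⟩ := hqb
  refine integrable_of_norm_le_div_pow_three (hp.mul hq) (r := max r r') (C := C * C')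
    (le_max_of_le_left hr) fun z hz => ?_
  have h1 := H z ((le_max_left _ _).trans hz)
  have h2 := H' z ((le_max_right _ _).trans hz)
  have hz1 : 1 ≤ ‖z‖ := hr.trans ((le_max_left _ _).trans hz)
  rw [norm_mul]
  calc ‖p z‖ * ‖q z‖ ≤ C / ‖z‖ ^ j * (C' / ‖z‖ ^ k) := by gcongr
    _ = C * C' / ‖z‖ ^ (j + k) := by rw [pow_add, div_mul_div_comm]
    _ ≤ C * C' / ‖z‖ ^ 3 := by gcongr

/-- The Beurling transform is an isometry of `L²`. -/
lemma integral_wdz_Kconv_mul_conj (θ : ℝ) {f : ℂ → ℂ} (hf : ContDiff ℝ 2 f)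
    (hc : HasCompactSupport f) :
    Integrable (fun z => wdz (Kconv θ f) z * (starRingEnd ℂ) (wdz (Kconv θ f) z)) ∧
    ∫ z, wdz (Kconv θ f) z * (starRingEnd ℂ) (wdz (Kconv θ f) z)
      = ∫ z, wdbar (Kconv θ f) z * (starRingEnd ℂ) (wdbar (Kconv θ f) z) := by
  set v := Kconv θ f with hv
  have hf1 : ContDiff ℝ 1 f := hf.of_le (by norm_num)
  have hv2 : ContDiff ℝ 2 v := contDiff_Kconv θ (n := 2) hf hc
  have hv1 : ContDiff ℝ 1 v := hv2.of_le (by norm_num)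
  have hp := contDiff_wdz hv2
  have dv : HolomorphicDecay 1 v := holomorphicDecay_Kconv θ hf1 hc
  have dp : HolomorphicDecay 2 (wdz v) := dv.wdz hv2
  set w : ℂ → ℂ := fun z => (starRingEnd ℂ) (v z) with hw
  have hw1 : ContDiff ℝ 1 w := conjCLE.contDiff.comp hv1
  have bw : ∃ r C : ℝ, 1 ≤ r ∧ 0 ≤ C ∧ ∀ z, r ≤ ‖z‖ → ‖w z‖ ≤ C / ‖z‖ ^ 1 := by
    simpa [hw] using dv.bound
  have bdw : ∀ u, ∃ r C : ℝ, 1 ≤ r ∧ 0 ≤ C ∧ ∀ z, r ≤ ‖z‖ → ‖fderiv ℝ w z u‖ ≤ C / ‖z‖ ^ 2 := by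
    intro u
    obtain ⟨r, C, hr, hC, H⟩ := dv.fderiv_le hv1
    refine ⟨r, C * ‖u‖, hr, by positivity, fun z hz => ?_⟩
    rw [hw, fderiv_conj_comp hv1, RCLike.norm_conj]
    exact (H z hz u).trans_eq (by ring)
  have bdp : ∀ u, ∃ r C : ℝ, 1 ≤ r ∧ 0 ≤ C ∧
      ∀ z, r ≤ ‖z‖ → ‖fderiv ℝ (wdz v) z u‖ ≤ C / ‖z‖ ^ 3 := by
    intro u
    obtain ⟨r, C, hr, hC, H⟩ := dp.fderiv_le hp
    refine ⟨r, C * ‖u‖, hr, by positivity, fun z hz => ?_⟩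
    exact (H z hz u).trans_eq (by ring)
  have ewbar : ∀ z, wdbar w z = (starRingEnd ℂ) (wdz v z) := by
    intro z
    rw [wdbar, hw, fderiv_conj_comp hv1, fderiv_conj_comp hv1, wdz]
    simp [map_ofNat]
  have ewz : ∀ z, wdz w z = (starRingEnd ℂ) (wdbar v z) := by
    intro z
    rw [wdz, hw, fderiv_conj_comp hv1, fderiv_conj_comp hv1, wdbar]
    simp [map_ofNat, sub_eq_add_neg]
  have hq : wdbar v = fun z => exp (θ * I) / 2 * f z := funext (wdbar_Kconv θ hf1 hc)
  have hq1 : ContDiff ℝ 1 (wdbar v) := by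
    rw [hq]
    exact contDiff_const.mul hf1
  have hqc : HasCompactSupport (wdbar v) := by
    rw [hq]
    exact hc.mul_left
  have ibp1 := integral_mul_fderiv_combination I hp hw1
    (fun u => integrable_mul_of_bounds (continuous_fderiv_apply hp u) hw1.continuous (by norm_num)
      (bdp u) bw)
    (fun u => integrable_mul_of_bounds hp.continuous (continuous_fderiv_apply hw1 u) (by norm_num)
      dp.bound (bdw u))
    (integrable_mul_of_bounds hp.continuous hw1.continuous (by norm_num) dp.bound bw)
  have ibp2 := integral_mul_fderiv_combination (-I) hq1 hw1
    (fun u => ((continuous_fderiv_apply hq1 u).mul hw1.continuous).integrable_of_hasCompactSupport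
      (hqc.fderiv_apply ℝ u).mul_right)
    (fun u => (hq1.continuous.mul (continuous_fderiv_apply hw1 u)).integrable_of_hasCompactSupport
      hqc.mul_right)
    ((hq1.continuous.mul hw1.continuous).integrable_of_hasCompactSupport hqc.mul_right)
  have e1 : ∀ z, (fderiv ℝ w z 1 + I * fderiv ℝ w z I) / 2 = (starRingEnd ℂ) (wdz v z) := ewbar
  have e2 : ∀ z, (fderiv ℝ (wdz v) z 1 + I * fderiv ℝ (wdz v) z I) / 2 = wdz (wdbar v) z :=
    wdbar_wdz hv2
  simp only [e1, e2] at ibp1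
  simp only [← wdz_eq, ewz] at ibp2
  refine ⟨?_, ibp1.trans ibp2.symm⟩
  refine integrable_mul_of_bounds hp.continuous (conjCLE.continuous.comp hp.continuous)
    (j := 2) (k := 2) (by norm_num) dp.bound ?_
  simpa using dp.bound

/-- The divergence of a vector field on `ℂ ≅ ℝ²`. -/
noncomputable def divergence (F : ℂ → ℂ) (z : ℂ) : ℝ :=
  (fderiv ℝ F z 1).re + (fderiv ℝ F z I).im

lemma divergence_eq (F : ℂ → ℂ) (z : ℂ) : divergence F z = 2 * (wdz F z).re := by
  simp [divergence, wdz]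
  ring

lemma integral_norm_wdz_Kconv_sq (θ : ℝ) {f : ℂ → ℝ} (hf : ContDiff ℝ 2 f)
    (hc : HasCompactSupport f) :
    Integrable (fun z => ‖wdz (Kconv θ fun y => (f y : ℂ)) z‖ ^ 2) ∧
    ∫ z, ‖wdz (Kconv θ fun y => (f y : ℂ)) z‖ ^ 2 = ∫ z, f z ^ 2 / 4 := by
  have hfc : ContDiff ℝ 2 fun y => (f y : ℂ) := ofRealCLM.contDiff.comp hf
  have hcc : HasCompactSupport fun y => (f y : ℂ) := hc.comp_left (g := ofReal) ofReal_zero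
  have hfc1 := hfc.of_le (show (1 : WithTop ℕ∞) ≤ 2 by norm_num)
  obtain ⟨hint, heq⟩ := integral_wdz_Kconv_mul_conj θ hfc hcc
  have hbar := wdbar_Kconv θ hfc1 hcc
  generalize (Kconv θ fun y => (f y : ℂ)) = v at hint heq hbar ⊢
  have hsq : ∀ z, wdz v z * (starRingEnd ℂ) (wdz v z) = ((‖wdz v z‖ ^ 2 : ℝ) : ℂ) := fun z => by
    rw [Complex.mul_conj, Complex.normSq_eq_norm_sq]
  have hsq' : ∀ z, wdbar v z * (starRingEnd ℂ) (wdbar v z) = ((f z ^ 2 / 4 : ℝ) : ℂ) := fun z => by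
    rw [Complex.mul_conj, Complex.normSq_eq_norm_sq, hbar, norm_mul, norm_div,
      Complex.norm_exp_ofReal_mul_I, Complex.norm_real, mul_pow, Real.norm_eq_abs, sq_abs]
    norm_num
    ring
  simp only [hsq, hsq', integral_complex_ofReal] at hint heq
  refine ⟨?_, Complex.ofReal_injective heq⟩
  have := hint.re
  simpa only [RCLike.re_to_complex, Complex.ofReal_re] using this

/-- If `f` vanishes off `F` and `|f| ≤ M`, the velocity field `K∗f` expands `F` at rate at
most `M`. -/
lemma setIntegral_divergence_Kconv_le (θ : ℝ) {f : ℂ → ℝ} (hf : ContDiff ℝ 2 f)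
    (hc : HasCompactSupport f) {M : ℝ} (hM : 0 < M) (hfM : ∀ z, |f z| ≤ M) {F : Set ℂ}
    (hF : MeasurableSet F) (hFfin : volume F ≠ ⊤) (hfF : ∀ z, z ∉ F → f z = 0) :
    ∫ z in F, divergence (Kconv θ fun y => (f y : ℂ)) z ≤ M * volume.real F := by
  obtain ⟨hint, heq⟩ := integral_norm_wdz_Kconv_sq θ hf hc
  generalize (Kconv θ fun y => (f y : ℂ)) = v at hint heq ⊢
  have hf2c : HasCompactSupport fun z => f z ^ 2 / 4 :=
    hc.comp_left (g := fun x : ℝ => x ^ 2 / 4) (by norm_num)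
  have hf2 : Integrable fun z => f z ^ 2 / 4 :=
    Continuous.integrable_of_hasCompactSupport ((hf.continuous.pow 2).div_const 4) hf2c
  have hfle : ∫ z, f z ^ 2 / 4 ≤ M ^ 2 / 4 * volume.real F := by
    rw [← setIntegral_eq_integral_of_forall_compl_eq_zero (s := F)
      (fun z hz => by rw [hfF z hz]; norm_num)]
    have := setIntegral_mono_on hf2.integrableOn
      (integrableOn_const hFfin (C := M ^ 2 / 4)) hF
      (fun z _ => by
        have := sq_le_sq' (abs_le.1 (hfM z)).1 (abs_le.1 (hfM z)).2
        linarith)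
    simpa [mul_comm] using this
  have hcst : IntegrableOn (fun _ : ℂ => M / 2) F := integrableOn_const hFfin
  have hb : IntegrableOn (fun z => 2 / M * ‖wdz v z‖ ^ 2 + M / 2) F :=
    (hint.integrableOn.const_mul _).add hcst
  have hle : ∀ z, |divergence v z| ≤ 2 / M * ‖wdz v z‖ ^ 2 + M / 2 := fun z => by
    rw [divergence_eq, abs_mul, abs_two]
    have h1 := Complex.abs_re_le_norm (wdz v z)
    have h2 : 2 / M * ‖wdz v z‖ ^ 2 + M / 2 - 2 * ‖wdz v z‖
        = (2 * ‖wdz v z‖ - M) ^ 2 / (2 * M) := by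
      field_simp
      ring
    have h3 : 0 ≤ (2 * ‖wdz v z‖ - M) ^ 2 / (2 * M) := by positivity
    linarith
  have hdm : Measurable (divergence v) := by
    unfold divergence
    fun_prop
  calc ∫ z in F, divergence v z
      ≤ ∫ z in F, (2 / M * ‖wdz v z‖ ^ 2 + M / 2) := by
        exact integral_mono (hb.mono' hdm.aestronglyMeasurable (.of_forall hle)) hb
          fun z => (le_abs_self _).trans (hle z)
    _ = 2 / M * (∫ z in F, ‖wdz v z‖ ^ 2) + M / 2 * volume.real F := by
        rw [integral_add (hint.integrableOn.const_mul _) hcst, integral_const_mul]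
        simp [mul_comm]
    _ ≤ 2 / M * (M ^ 2 / 4 * volume.real F) + M / 2 * volume.real F := by
        gcongr
        exact (setIntegral_le_integral hint (.of_forall fun z => by positivity)).trans
          (heq.le.trans hfle)
    _ = M * volume.real F := by
        field_simp
        ring

section Slices

variable {V : Type*} [NormedAddCommGroup V] [NormedSpace ℝ V] {Y : ℝ → ℂ → V}

lemma fderiv_slice (hY : ContDiff ℝ 1 fun p : ℝ × ℂ => Y p.1 p.2) (t : ℝ) (z w : ℂ) :
    fderiv ℝ (Y t) z w = fderiv ℝ (fun p : ℝ × ℂ => Y p.1 p.2) (t, z) (0, w) := by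
  have h := ((hY.differentiable one_ne_zero (t, z)).hasFDerivAt).comp z
    (hasFDerivAt_prodMk_right t z)
  exact congrArg (fun L : ℂ →L[ℝ] V => L w) h.fderiv

lemma deriv_slice (hY : ContDiff ℝ 1 fun p : ℝ × ℂ => Y p.1 p.2) (t : ℝ) (z : ℂ) :
    deriv (fun s => Y s z) t = fderiv ℝ (fun p : ℝ × ℂ => Y p.1 p.2) (t, z) (1, 0) := by
  have h := ((hY.differentiable one_ne_zero (t, z)).hasFDerivAt).comp_hasDerivAt t
    ((hasDerivAt_id t).prodMk (hasDerivAt_const t z))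
  exact h.deriv

/-- Time and space derivatives commute. -/
lemma hasDerivAt_fderiv_slice (hY : ContDiff ℝ 2 fun p : ℝ × ℂ => Y p.1 p.2) (t : ℝ) (z w : ℂ) :
    HasDerivAt (fun s => fderiv ℝ (Y s) z w)
      (fderiv ℝ (fun y => deriv (fun s => Y s y) t) z w) t := by
  have hY1 : ContDiff ℝ 1 fun p : ℝ × ℂ => Y p.1 p.2 := hY.of_le (by norm_num)
  simp only [fderiv_slice hY1, deriv_slice hY1]
  set G : ℝ × ℂ → V := fun p => Y p.1 p.2 with hG
  have hD : DifferentiableAt ℝ (fderiv ℝ G) (t, z) :=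
    (hY.fderiv_right (m := 1) (by norm_num)).differentiable one_ne_zero (t, z)
  have hs : IsSymmSndFDerivAt ℝ G (t, z) := hY.contDiffAt.isSymmSndFDerivAt (by simp)
  have h1 : HasFDerivAt (fun y => fderiv ℝ G (t, y) (1, 0))
      (((ContinuousLinearMap.apply ℝ V ((1, 0) : ℝ × ℂ)).comp (fderiv ℝ (fderiv ℝ G) (t, z))).comp
        (ContinuousLinearMap.inr ℝ ℝ ℂ)) z :=
    ((ContinuousLinearMap.apply ℝ V ((1, 0) : ℝ × ℂ)).hasFDerivAt.comp (t, z)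
      hD.hasFDerivAt).comp z (hasFDerivAt_prodMk_right t z)
  have h2 := (ContinuousLinearMap.apply ℝ V ((0, w) : ℝ × ℂ)).hasFDerivAt.comp_hasDerivAt t
    (hD.hasFDerivAt.comp_hasDerivAt t ((hasDerivAt_id t).prodMk (hasDerivAt_const t z)))
  rw [h1.fderiv]
  convert! h2 using 1
  exact hs.eq _ _

end Slices

/-- The Jacobian determinant of the time-`t` map of a flow. -/
noncomputable def flowJac (X : ℝ → ℂ → ℂ) (t : ℝ) (z : ℂ) : ℝ :=
  (fderiv ℝ (X t) z 1).re * (fderiv ℝ (X t) z I).im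
    - (fderiv ℝ (X t) z 1).im * (fderiv ℝ (X t) z I).re

lemma det_fderiv_eq_flowJac (X : ℝ → ℂ → ℂ) (t : ℝ) (z : ℂ) :
    LinearMap.det ((fderiv ℝ (X t) z) : ℂ →ₗ[ℝ] ℂ) = flowJac X t z := by
  rw [← LinearMap.det_toMatrix Complex.basisOneI, Matrix.det_fin_two, flowJac]
  simp [LinearMap.toMatrix_apply]
  ring

lemma contDiff_flowJac {X : ℝ → ℂ → ℂ} (hX : ContDiff ℝ 2 fun p : ℝ × ℂ => X p.1 p.2) :
    ContDiff ℝ 1 fun p : ℝ × ℂ => flowJac X p.1 p.2 := by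
  have hX1 : ContDiff ℝ 1 fun p : ℝ × ℂ => X p.1 p.2 := hX.of_le (by norm_num)
  simp only [flowJac, fderiv_slice hX1]
  have h : ContDiff ℝ 1 (fderiv ℝ fun p : ℝ × ℂ => X p.1 p.2) := hX.fderiv_right (by norm_num)
  have hw : ∀ w : ℂ, ContDiff ℝ 1
      fun p : ℝ × ℂ => fderiv ℝ (fun p : ℝ × ℂ => X p.1 p.2) (p.1, p.2) (0, w) :=
    fun w => h.clm_apply contDiff_const
  have hre : ∀ w, ContDiff ℝ 1
      fun p : ℝ × ℂ => (fderiv ℝ (fun p : ℝ × ℂ => X p.1 p.2) (p.1, p.2) (0, w)).re :=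
    fun w => reCLM.contDiff.comp (hw w)
  have him : ∀ w, ContDiff ℝ 1
      fun p : ℝ × ℂ => (fderiv ℝ (fun p : ℝ × ℂ => X p.1 p.2) (p.1, p.2) (0, w)).im :=
    fun w => imCLM.contDiff.comp (hw w)
  exact ((hre 1).mul (him I)).sub ((him 1).mul (hre I))

/-- Liouville's formula. -/
lemma hasDerivAt_flowJac {X : ℝ → ℂ → ℂ} (hX : ContDiff ℝ 2 fun p : ℝ × ℂ => X p.1 p.2)
    {v : ℂ → ℂ} (hv : ContDiff ℝ 1 v) {t : ℝ}
    (hflow : ∀ y, deriv (fun s => X s y) t = v (X t y)) (z : ℂ) :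
    HasDerivAt (fun s => flowJac X s z) (divergence v (X t z) * flowJac X t z) t := by
  have hXt : DifferentiableAt ℝ (X t) z :=
    ((hX.comp (contDiff_prodMk_right t)).differentiable two_ne_zero) z
  have hd : ∀ w, HasDerivAt (fun s => fderiv ℝ (X s) z w)
      (fderiv ℝ v (X t z) (fderiv ℝ (X t) z w)) t := by
    intro w
    have h := hasDerivAt_fderiv_slice hX t z w
    simp only [hflow] at h
    have hc := ((hv.differentiable one_ne_zero (X t z)).hasFDerivAt.comp z hXt.hasFDerivAt).fderiv
    have := congrArg (fun L : ℂ →L[ℝ] ℂ => L w) hc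
    rw [show fderiv ℝ (fun y => v (X t y)) z w = fderiv ℝ v (X t z) (fderiv ℝ (X t) z w)
      from this] at h
    exact h
  have hre : ∀ w, HasDerivAt (fun s => (fderiv ℝ (X s) z w).re)
      (fderiv ℝ v (X t z) (fderiv ℝ (X t) z w)).re t :=
    fun w => reCLM.hasFDerivAt.comp_hasDerivAt t (hd w)
  have him : ∀ w, HasDerivAt (fun s => (fderiv ℝ (X s) z w).im)
      (fderiv ℝ v (X t z) (fderiv ℝ (X t) z w)).im t :=
    fun w => imCLM.hasFDerivAt.comp_hasDerivAt t (hd w)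
  have h := ((hre 1).mul (him I)).sub ((him 1).mul (hre I))
  convert! h using 1
  rw [fderiv_apply_eq_re_im _ (fderiv ℝ (X t) z 1), fderiv_apply_eq_re_im _ (fderiv ℝ (X t) z I)]
  simp only [divergence, flowJac, add_re, add_im, re_ofReal_mul, im_ofReal_mul]
  ring

lemma hasDerivAt_setIntegral {J : ℝ → ℂ → ℝ} (hJ : ContDiff ℝ 1 fun p : ℝ × ℂ => J p.1 p.2)
    {E : Set ℂ} {R : ℝ} (hER : E ⊆ Metric.closedBall 0 R) (t : ℝ) :
    HasDerivAt (fun s => ∫ z in E, J s z) (∫ z in E, deriv (fun s => J s z) t) t := by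
  have hfin : volume E ≠ ⊤ :=
    ((measure_mono hER).trans_lt (isCompact_closedBall (0 : ℂ) R).measure_lt_top).ne
  have hcJ : ∀ s, Continuous (J s) := fun s =>
    hJ.continuous.comp (Continuous.prodMk_right s)
  have hcd : Continuous fun p : ℝ × ℂ => deriv (fun s => J s p.2) p.1 := by
    simp only [deriv_slice hJ]
    exact (hJ.continuous_fderiv one_ne_zero).clm_apply continuous_const
  obtain ⟨C, hC⟩ := ((isCompact_closedBall t 1).prod
    (isCompact_closedBall (0 : ℂ) R)).exists_bound_of_continuousOn hcd.continuousOn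
  have hsub : ∀ᵐ z ∂volume.restrict E, z ∈ Metric.closedBall (0 : ℂ) R :=
    ae_restrict_of_ae_restrict_of_subset hER
      (ae_restrict_mem (measurableSet_closedBall))
  refine (hasDerivAt_integral_of_dominated_loc_of_deriv_le (bound := fun _ => C)
    (F' := fun s z => deriv (fun s => J s z) s)
    (Metric.closedBall_mem_nhds t one_pos)
    (.of_forall fun s => (hcJ s).aestronglyMeasurable) ?_
    (hcd.comp (Continuous.prodMk_right t)).aestronglyMeasurable ?_
    (integrableOn_const hfin) ?_).2
  · exact ((hcJ t).continuousOn.integrableOn_compact (isCompact_closedBall (0 : ℂ) R)).mono_set hER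
  · filter_upwards [hsub] with z hz s hs using hC (s, z) ⟨hs, hz⟩
  · refine .of_forall fun z s _ => DifferentiableAt.hasDerivAt ?_
    exact (hJ.comp (contDiff_prodMk_left z)).differentiable one_ne_zero s

namespace SmoothSetting

variable (S : SmoothSetting)

/-- The vorticity is transported by the flow. -/
lemma vorticity_flow {t : ℝ} (ht : t ∈ Set.Icc (0 : ℝ) S.T) (z : ℂ) :
    S.ω t (S.X t z) = S.ω₀ z := by
  have hω1 : ContDiff ℝ 1 fun p : ℝ × ℂ => S.ω p.1 p.2 :=
    S.hωsmooth.of_le (by exact_mod_cast le_top)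
  have hX1 : ContDiff ℝ 1 fun p : ℝ × ℂ => S.X p.1 p.2 :=
    S.hXsmooth.of_le (by exact_mod_cast le_top)
  have hd : ∀ s ∈ Set.Icc (0 : ℝ) S.T, HasDerivAt (fun s => S.ω s (S.X s z)) 0 s := by
    intro s hs
    have hXd : HasDerivAt (fun s => S.X s z) (Kconv S.θ (fun y => (S.ω s y : ℂ)) (S.X s z)) s := by
      rw [← S.hXflow s hs z]
      exact ((hX1.comp (contDiff_prodMk_left z)).differentiable one_ne_zero s).hasDerivAt
    have h := ((hω1.differentiable one_ne_zero (s, S.X s z)).hasFDerivAt).comp_hasDerivAt s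
      ((hasDerivAt_id s).prodMk hXd)
    have ht := S.htransport s hs (S.X s z)
    set u := Kconv S.θ (fun y => (S.ω s y : ℂ)) (S.X s z) with hu
    convert! h using 1
    rw [← ht, deriv_slice hω1, fderiv_slice hω1, fderiv_slice hω1]
    have hdec : ((1 : ℝ), u) = (1, 0) + (u.re • (0, 1) + u.im • ((0 : ℝ), I)) := by
      ext <;> simp
    rw [hdec, map_add, map_add, map_smul, map_smul, smul_eq_mul, smul_eq_mul, add_assoc]
  have := constant_of_has_deriv_right_zero (f := fun s => S.ω s (S.X s z)) (a := 0) (b := S.T)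
    (fun s hs => (hd s hs).continuousAt.continuousWithinAt)
    (fun s hs => (hd s ⟨hs.1, hs.2.le⟩).hasDerivWithinAt) t ht
  simpa [S.hXinit, S.hωinit] using this

lemma abs_vorticity_le {t : ℝ} (ht : t ∈ Set.Icc (0 : ℝ) S.T) (z : ℂ) :
    |S.ω t z| ≤ supNorm S.ω₀ := by
  obtain ⟨y, rfl⟩ := (S.hXbij t ht).2 z
  rw [S.vorticity_flow ht]
  obtain ⟨C, hC⟩ := S.hω₀supp.exists_bound_of_continuous S.hω₀smooth.continuous
  exact le_ciSup (f := fun z => |S.ω₀ z|) ⟨C, by rintro _ ⟨x, rfl⟩; exact hC x⟩ y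

lemma hasFDerivWithinAt_flow (t : ℝ) (E : Set ℂ) (z : ℂ) :
    HasFDerivWithinAt (S.X t) (fderiv ℝ (S.X t) z) E z := by
  have h : ContDiff ℝ (⊤ : ℕ∞) (S.X t) := S.hXsmooth.comp (contDiff_prodMk_right t)
  exact (h.differentiable (by simp) z).hasFDerivAt.hasFDerivWithinAt

lemma flowJac_pos {t : ℝ} (ht : t ∈ Set.Icc (0 : ℝ) S.T) (z : ℂ) : 0 < flowJac S.X t z := by
  rw [← det_fderiv_eq_flowJac]
  exact S.hXjac t ht z

lemma volume_image_eq {t : ℝ} (ht : t ∈ Set.Icc (0 : ℝ) S.T) {E : Set ℂ} (hE : MeasurableSet E) :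
    volume (S.X t '' E) = ∫⁻ z in E, ENNReal.ofReal (flowJac S.X t z) := by
  rw [← lintegral_abs_det_fderiv_eq_addHaar_image volume hE
    (fun z _ => S.hasFDerivWithinAt_flow t E z) (S.hXbij t ht).1.injOn]
  congr 1
  ext z
  rw [ContinuousLinearMap.det, det_fderiv_eq_flowJac, abs_of_pos (S.flowJac_pos ht z)]

lemma setIntegral_image_eq {t : ℝ} (ht : t ∈ Set.Icc (0 : ℝ) S.T) {E : Set ℂ}
    (hE : MeasurableSet E) (g : ℂ → ℝ) :
    ∫ y in S.X t '' E, g y = ∫ z in E, g (S.X t z) * flowJac S.X t z := by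
  rw [integral_image_eq_integral_abs_det_fderiv_smul volume hE
    (fun z _ => S.hasFDerivWithinAt_flow t E z) (S.hXbij t ht).1.injOn]
  congr 1
  ext z
  rw [ContinuousLinearMap.det, det_fderiv_eq_flowJac, abs_of_pos (S.flowJac_pos ht z), smul_eq_mul,
    mul_comm]

lemma contDiff_flow : ContDiff ℝ 2 fun p : ℝ × ℂ => S.X p.1 p.2 :=
  S.hXsmooth.of_le (WithTop.coe_le_coe.2 (le_top : (2 : ℕ∞) ≤ ⊤))

lemma integrableOn_flowJac (t : ℝ) {E : Set ℂ} {R : ℝ} (hER : E ⊆ Metric.closedBall 0 R) :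
    IntegrableOn (flowJac S.X t) E := by
  have hc : Continuous (flowJac S.X t) :=
    (contDiff_flowJac S.contDiff_flow).continuous.comp (Continuous.prodMk_right t)
  exact (hc.continuousOn.integrableOn_compact (isCompact_closedBall (0 : ℂ) R)).mono_set hER

lemma volume_image_eq_ofReal {t : ℝ} (ht : t ∈ Set.Icc (0 : ℝ) S.T) {E : Set ℂ}
    (hE : MeasurableSet E) {R : ℝ} (hER : E ⊆ Metric.closedBall 0 R) :
    volume (S.X t '' E) = ENNReal.ofReal (∫ z in E, flowJac S.X t z) := by
  rw [S.volume_image_eq ht hE, ofReal_integral_eq_lintegral_ofReal (S.integrableOn_flowJac t hER)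
    (.of_forall fun z => (S.flowJac_pos ht z).le)]

lemma deriv_area_le {t : ℝ} (ht : t ∈ Set.Icc (0 : ℝ) S.T) {E : Set ℂ}
    (hE : MeasurableSet E) {R : ℝ} (hER : E ⊆ Metric.closedBall 0 R) (hsupp : tsupport S.ω₀ ⊆ E)
    {M : ℝ} (hM : supNorm S.ω₀ < M) :
    ∫ z in E, deriv (fun s => flowJac S.X s z) t ≤ M * ∫ z in E, flowJac S.X t z := by
  have hsm : ContDiff ℝ 2 (S.ω t) :=
    (S.hωsmooth.comp (contDiff_prodMk_right t)).of_le (WithTop.coe_le_coe.2 (le_top : (2 : ℕ∞) ≤ ⊤))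
  have hsmc : ContDiff ℝ 1 fun y => (S.ω t y : ℂ) :=
    (ofRealCLM.contDiff.comp hsm).of_le (by norm_num)
  have hcc : HasCompactSupport fun y => (S.ω t y : ℂ) :=
    (S.hωsupp t).comp_left (g := ofReal) ofReal_zero
  have hv : ContDiff ℝ 1 (Kconv S.θ fun y => (S.ω t y : ℂ)) := contDiff_Kconv S.θ (n := 1) hsmc hcc
  have hL := fun z => (hasDerivAt_flowJac S.contDiff_flow hv (S.hXflow t ht) z).deriv
  have hM0 : 0 < M := ((abs_nonneg _).trans (S.abs_vorticity_le ht 0)).trans_lt hM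
  have hvol := S.volume_image_eq_ofReal ht hE hER
  have hmeas : MeasurableSet (S.X t '' E) :=
    measurable_image_of_fderivWithin hE (fun z _ => S.hasFDerivWithinAt_flow t E z)
      (S.hXbij t ht).1.injOn
  have hoff : ∀ y, y ∉ S.X t '' E → S.ω t y = 0 := by
    intro y hy
    obtain ⟨z, rfl⟩ := (S.hXbij t ht).2 y
    rw [S.vorticity_flow ht]
    by_contra hne
    exact hy ⟨z, hsupp (subset_tsupport _ hne), rfl⟩
  have key := setIntegral_divergence_Kconv_le S.θ hsm (S.hωsupp t) hM0
    (fun z => (S.abs_vorticity_le ht z).trans hM.le) hmeas (by rw [hvol]; exact ofReal_ne_top) hoff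
  rw [S.setIntegral_image_eq ht hE, Measure.real, hvol, toReal_ofReal
    (integral_nonneg fun z => (S.flowJac_pos ht z).le)] at key
  simpa only [hL] using key

lemma integral_flowJac_le {t : ℝ} (ht : t ∈ Set.Icc (0 : ℝ) S.T) {E : Set ℂ}
    (hE : MeasurableSet E) {R : ℝ} (hER : E ⊆ Metric.closedBall 0 R) (hsupp : tsupport S.ω₀ ⊆ E)
    {M : ℝ} (hM : supNorm S.ω₀ < M) :
    ∫ z in E, flowJac S.X t z ≤ Real.exp (t * M) * volume.real E := by
  set a : ℝ → ℝ := fun s => ∫ z in E, flowJac S.X s z with ha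
  have hda : ∀ s, HasDerivAt a (∫ z in E, deriv (fun s => flowJac S.X s z) s) s :=
    hasDerivAt_setIntegral (contDiff_flowJac S.contDiff_flow) hER
  have hexp : ∀ s, HasDerivAt (fun s : ℝ => Real.exp (-(s * M))) (Real.exp (-(s * M)) * -M) s :=
    fun s => by simpa using! ((hasDerivAt_id s).mul_const M).neg.exp
  have hdb := fun s => (hexp s).mul (hda s)
  have hanti : AntitoneOn (fun s => Real.exp (-(s * M)) * a s) (Set.Icc 0 S.T) := by
    refine antitoneOn_of_deriv_nonpos (convex_Icc 0 S.T)
      (fun s _ => (hdb s).continuousAt.continuousWithinAt)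
      (fun s _ => (hdb s).differentiableAt.differentiableWithinAt) fun s hs => ?_
    rw [interior_Icc] at hs
    have h := S.deriv_area_le ⟨hs.1.le, hs.2.le⟩ hE hER hsupp hM
    have hd : deriv (fun s => Real.exp (-(s * M)) * a s) s = _ := (hdb s).deriv
    rw [hd]
    nlinarith [Real.exp_pos (-(s * M))]
  have h := hanti ⟨le_rfl, S.hT.le⟩ ht ht.1
  have h0 : a 0 = volume.real E := by
    have hid : S.X 0 = id := funext S.hXinit
    simp [ha, flowJac, hid]
  simp only [zero_mul, neg_zero, Real.exp_zero, one_mul, h0] at h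
  calc a t = Real.exp (t * M) * (Real.exp (-(t * M)) * a t) := by
        rw [← mul_assoc, ← Real.exp_add]
        simp
    _ ≤ _ := by gcongr

lemma volume_image_le_of_bounded {t : ℝ} (ht : t ∈ Set.Icc (0 : ℝ) S.T) {E : Set ℂ}
    (hE : MeasurableSet E) {R : ℝ} (hER : E ⊆ Metric.closedBall 0 R)
    (hsupp : tsupport S.ω₀ ⊆ E) :
    volume (S.X t '' E) ≤ ENNReal.ofReal (Real.exp (t * supNorm S.ω₀)) * volume E := by
  have hfin : volume E ≠ ⊤ :=
    ((measure_mono hER).trans_lt (isCompact_closedBall (0 : ℂ) R).measure_lt_top).ne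
  have hle : ∫ z in E, flowJac S.X t z ≤ Real.exp (t * supNorm S.ω₀) * volume.real E := by
    have hc : Continuous fun M : ℝ => Real.exp (t * M) * volume.real E := by fun_prop
    refine ge_of_tendsto (hc.continuousWithinAt (s := Set.Ioi (supNorm S.ω₀))).tendsto ?_
    filter_upwards [self_mem_nhdsWithin] with M hM
      using S.integral_flowJac_le ht hE hER hsupp hM
  rw [S.volume_image_eq_ofReal ht hE hER, ← ofReal_toReal hfin, ← ofReal_mul (Real.exp_pos _).le]
  exact ofReal_le_ofReal hle

lemma volume_image_le {t : ℝ} (ht : t ∈ Set.Icc (0 : ℝ) S.T) {E : Set ℂ}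
    (hE : MeasurableSet E) (hsupp : tsupport S.ω₀ ⊆ E) :
    volume (S.X t '' E) ≤ ENNReal.ofReal (Real.exp (t * supNorm S.ω₀)) * volume E := by
  obtain ⟨R, hR⟩ := S.hω₀supp.isCompact.isBounded.subset_closedBall 0
  have hU : S.X t '' E = ⋃ n : ℕ, S.X t '' (E ∩ Metric.closedBall 0 (R + n)) := by
    rw [← Set.image_iUnion, ← Set.inter_iUnion]
    congr 1
    refine (Set.inter_eq_left.2 fun z _ => ?_).symm
    obtain ⟨n, hn⟩ := exists_nat_ge (‖z‖ - R)
    exact Set.mem_iUnion.2 ⟨n, mem_closedBall_zero_iff.2 (by linarith)⟩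
  have hmono : Monotone fun n : ℕ => S.X t '' (E ∩ Metric.closedBall 0 (R + n)) := by
    intro m n hmn
    have : (m : ℝ) ≤ n := by exact_mod_cast hmn
    exact Set.image_mono (Set.inter_subset_inter_right _ (Metric.closedBall_subset_closedBall
      (by linarith)))
  rw [hU, hmono.measure_iUnion]
  refine iSup_le fun n => ?_
  refine (S.volume_image_le_of_bounded ht (hE.inter measurableSet_closedBall)
    Set.inter_subset_right (Set.subset_inter hsupp (hR.trans
      (Metric.closedBall_subset_closedBall (by simp))))).trans ?_
  gcongr
  exact Set.inter_subset_left

end SmoothSetting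

/-- in the smooth setting, for every measurable set `E ⊇ supp ω₀`, the
area of the image satisfies `|X(t,E)| = ∫_E det DX(t,z) dA(z) ≤ e^{t‖ω₀‖_∞} · |E|`. -/
theorem area_distortion (S : SmoothSetting) :
    ∀ t ∈ Set.Icc (0 : ℝ) S.T, ∀ E : Set ℂ, MeasurableSet E → tsupport S.ω₀ ⊆ E →
      volume (S.X t '' E)
          = ∫⁻ z in E, ENNReal.ofReal (LinearMap.det ((fderiv ℝ (S.X t) z) : ℂ →ₗ[ℝ] ℂ)) ∧
      volume (S.X t '' E) ≤ ENNReal.ofReal (Real.exp (t * supNorm S.ω₀)) * volume E := by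
  intro t ht E hE hsupp
  refine ⟨?_, S.volume_image_le ht hE hsupp⟩
  simp only [det_fderiv_eq_flowJac]
  exact S.volume_image_eq ht hE
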